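/- arXiv:2012.13661 — 3 statements merged into one kernel-verified Lean document; each statement's English description precedes it below -/
import Mathlib

section
/- Let G be the wallpaper group p3 given by the presentation ⟨S₁, S₂ | S₁³ = S₂³ = (S₁S₂)³ = 1⟩, with generating set S the images of S₁, S₂ (Cayley graph the tiling (3.6)²). Then the spherical growth function satisfies δ(0) = 1, δ(1) = 4, and for all n > 1: δ(n) = 5n − 2 if n is even, and δ(n) = 4n + 2 if n is odd. -/
/-- Word length w.r.t. `S ∪ S⁻¹`. -/
noncomputable def wordLength {G : Type*} [Group G] (S : Set G) (g : G) : ℕ :=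
  sInf {n | ∃ w : List G, (∀ x ∈ w, x ∈ S ∪ S⁻¹) ∧ w.length = n ∧ w.prod = g}

/-- The spherical growth function `δ(n) = #{g : |g| = n}`. -/
noncomputable def sphericalGrowth {G : Type*} [Group G] (S : Set G) (n : ℕ) : ℕ :=
  Set.ncard {g : G | wordLength S g = n}

/-- The cumulative growth function `γ(n) = #{g : |g| ≤ n}`. -/
noncomputable def cumulativeGrowth {G : Type*} [Group G] (S : Set G) (n : ℕ) : ℕ :=
  Set.ncard {g : G | wordLength S g ≤ n}

/-- The relators of the wallpaper group `p3 = ⟨S₁,S₂ | S₁³ = S₂³ = (S₁S₂)³ = 1⟩`. -/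
def p3Rels : Set (FreeGroup (Fin 2)) :=
  {(FreeGroup.of 0) ^ 3, (FreeGroup.of 1) ^ 3, (FreeGroup.of 0 * FreeGroup.of 1) ^ 3}

namespace P3Growth

/-- Vertices of the Cayley graph: `ℤ[ω]` (coordinates `a + b ω`) times `ℤ/3`. -/
abbrev X : Type := ℤ × ℤ × Fin 3

def r1 : X → X
  | (a, b, 0) => (a, b, 1)
  | (a, b, 1) => (a, b, 2)
  | (a, b, 2) => (a, b, 0)

def r1i : X → X
  | (a, b, 0) => (a, b, 2)
  | (a, b, 1) => (a, b, 0)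
  | (a, b, 2) => (a, b, 1)

def r2 : X → X
  | (a, b, 0) => (a + 1, b, 1)
  | (a, b, 1) => (a, b + 1, 2)
  | (a, b, 2) => (a - 1, b - 1, 0)

def r2i : X → X
  | (a, b, 0) => (a + 1, b + 1, 2)
  | (a, b, 1) => (a - 1, b, 0)
  | (a, b, 2) => (a, b - 1, 1)

/-- The explicit length function. -/
def len : X → ℕ
  | (a, b, 0) => 2 * max (max a.natAbs b.natAbs) (a - b).natAbs + if a = 0 ∧ b ≠ 0 then 1 else 0
  | (a, b, 1) => max (max (2 * a - 1).natAbs (2 * b).natAbs) (2 * (a - b) - 1).natAbs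
  | (a, b, 2) => max (max (2 * a - 1).natAbs (2 * b - 1).natAbs) (2 * (a - b)).natAbs

lemma forallX {p : X → Prop} (h0 : ∀ a b, p (a, b, 0)) (h1 : ∀ a b, p (a, b, 1))
    (h2 : ∀ a b, p (a, b, 2)) : ∀ x, p x := by
  rintro ⟨a, b, k⟩
  fin_cases k
  · exact h0 a b
  · exact h1 a b
  · exact h2 a b

def R1 : Equiv.Perm X where
  toFun := r1
  invFun := r1i
  left_inv := forallX (fun _ _ => rfl) (fun _ _ => rfl) (fun _ _ => rfl)
  right_inv := forallX (fun _ _ => rfl) (fun _ _ => rfl) (fun _ _ => rfl)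

def R2 : Equiv.Perm X where
  toFun := r2
  invFun := r2i
  left_inv := by
    refine forallX ?_ ?_ ?_ <;> intro a b <;> simp [r2, r2i]
  right_inv := by
    refine forallX ?_ ?_ ?_ <;> intro a b <;> simp [r2, r2i]

def gens : Fin 2 → Equiv.Perm X := ![R1, R2]

lemma gens_rels : ∀ r ∈ p3Rels, FreeGroup.lift gens r = 1 := by
  intro r hr
  simp only [p3Rels, Set.mem_insert_iff, Set.mem_singleton_iff] at hr
  rcases hr with rfl | rfl | rfl <;> apply Equiv.ext <;> refine forallX ?_ ?_ ?_ <;> intro a b <;>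
    simp [gens, pow_succ, R1, R2, r1, r2]

abbrev P : Type := PresentedGroup p3Rels

def Φ : P →* Equiv.Perm X := PresentedGroup.toGroup gens_rels

def s : P := PresentedGroup.of 0
def t : P := PresentedGroup.of 1

lemma Φ_s : Φ s = R1 := by simp [Φ, s, gens]
lemma Φ_t : Φ t = R2 := by simp [Φ, t, gens]

lemma rel_s : s * s * s = 1 := by
  have h : PresentedGroup.mk p3Rels ((FreeGroup.of 0) ^ 3) = 1 :=
    PresentedGroup.one_of_mem (by simp [p3Rels])
  rw [map_pow] at h
  simp only [pow_succ, pow_zero, one_mul] at h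
  exact h

lemma rel_t : t * t * t = 1 := by
  have h : PresentedGroup.mk p3Rels ((FreeGroup.of 1) ^ 3) = 1 :=
    PresentedGroup.one_of_mem (by simp [p3Rels])
  rw [map_pow] at h
  simp only [pow_succ, pow_zero, one_mul] at h
  exact h

lemma rel_st : s * t * (s * t) * (s * t) = 1 := by
  have h : PresentedGroup.mk p3Rels ((FreeGroup.of 0 * FreeGroup.of 1) ^ 3) = 1 :=
    PresentedGroup.one_of_mem (by simp [p3Rels])
  rw [map_pow, map_mul] at h
  simp only [pow_succ, pow_zero, one_mul] at h
  exact h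

def x : P := s⁻¹ * t
def y : P := s * t * s

lemma s_inv : s⁻¹ = s * s := by
  rw [inv_eq_iff_mul_eq_one, ← mul_assoc, rel_s]

lemma t_inv : t⁻¹ = t * t := by
  rw [inv_eq_iff_mul_eq_one, ← mul_assoc, rel_t]

lemma yx : y * x = s * t⁻¹ := by
  rw [t_inv, x, y]; group

lemma xy : x * y = s * t⁻¹ := by
  have h : t * (s * t) * (s * t) = s⁻¹ := by
    rw [eq_inv_iff_mul_eq_one, ← mul_left_cancel_iff (a := s), ← mul_left_inj (a := s⁻¹)]
    have := rel_st
    simp only [mul_assoc] at this ⊢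
    simp [this]
  have h' : x * y = s⁻¹ * (t * (s * t) * (s * t)) * t⁻¹ := by rw [x, y]; group
  rw [h', h]
  rw [show s⁻¹ * s⁻¹ = s by rw [← mul_inv_rev, ← s_inv, inv_inv]]

lemma comm_xy : Commute x y := xy.trans yx.symm

/-- Inverse of the orbit map. -/
def f : X → P
  | (a, b, 0) => x ^ a * y ^ b
  | (a, b, 1) => s * (x ^ a * y ^ b)
  | (a, b, 2) => s * s * (x ^ a * y ^ b)

lemma f_s : ∀ p, f (Φ s p) = s * f p := by
  rw [Φ_s]
  refine forallX ?_ ?_ ?_ <;> intro a b <;> simp only [R1, r1, f, Equiv.coe_fn_mk]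
  · rw [mul_assoc]
  · rw [← mul_assoc, ← mul_assoc s, rel_s, one_mul]

lemma f_t : ∀ p, f (Φ t p) = t * f p := by
  rw [Φ_t]
  refine forallX ?_ ?_ ?_ <;> intro a b <;> simp only [R2, r2, f, Equiv.coe_fn_mk]
  · have h1 : s * x = t := by rw [x]; group
    rw [add_comm, zpow_add, zpow_one, mul_assoc x, ← mul_assoc s, h1]
  · rw [add_comm, zpow_add, zpow_one, ← mul_assoc (x ^ a), (comm_xy.zpow_left a).eq,
      mul_assoc y, ← mul_assoc (s * s), ← mul_assoc t]
    congr 1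
    rw [y, ← mul_assoc, ← mul_assoc, rel_s, one_mul]
  · have h1 : t * (s * s) = (x * y)⁻¹ := by rw [xy, ← s_inv]; group
    rw [← mul_assoc t, h1, eq_inv_mul_iff_mul_eq, sub_eq_add_neg, sub_eq_add_neg,
      add_comm, zpow_add, add_comm, zpow_add, zpow_neg_one, zpow_neg_one,
      comm_xy.eq, ← mul_assoc, mul_assoc y, ← mul_assoc x, mul_inv_cancel, one_mul,
      mul_assoc, ← mul_assoc (x ^ a), (comm_xy.inv_right.zpow_left a).eq]
    group

lemma f_equiv (g : P) : ∀ p, f (Φ g p) = g * f p := by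
  have hg : g ∈ Subgroup.closure (Set.range (PresentedGroup.of (rels := p3Rels))) := by
    rw [PresentedGroup.closure_range_of]; trivial
  induction hg using Subgroup.closure_induction with
  | mem g hg =>
    obtain ⟨i, rfl⟩ := hg
    fin_cases i
    · exact f_s
    · exact f_t
  | one => simp
  | mul g h _ _ ihg ihh => intro p; rw [map_mul, Equiv.Perm.mul_apply, ihg, ihh, mul_assoc]
  | inv g _ ih =>
    intro p
    rw [eq_inv_mul_iff_mul_eq, ← ih, ← Equiv.Perm.mul_apply, ← map_mul]; simp

def ψ (g : P) : X := Φ g (0, 0, 0)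

lemma ψ_inj : Function.Injective ψ := by
  have h : ∀ g, f (ψ g) = g := by intro g; rw [ψ, f_equiv]; simp [f]
  exact Function.LeftInverse.injective h

lemma len_zero : ∀ p, len p = 0 → p = (0, 0, 0) := by
  refine forallX ?_ ?_ ?_ <;> intro a b h <;> simp only [len] at h
  · have : a = 0 ∧ b = 0 := by split_ifs at h <;> omega
    simp [this]
  · omega
  · omega

set_option maxHeartbeats 4000000 in
lemma len_descent0 (n : ℕ) (a b : ℤ) (hn : len (a, b, 0) = n + 1) :
    len (r1 (a, b, 0)) = n ∨ len (r1i (a, b, 0)) = n ∨ len (r2 (a, b, 0)) = n ∨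
      len (r2i (a, b, 0)) = n := by
  simp only [len, r1, r1i, r2, r2i] at hn ⊢
  rcases le_or_gt a 0 with ha | ha <;> rcases le_or_gt b 0 with hb | hb <;>
    rcases lt_trichotomy a b with hc | hc | hc <;>
    (try split_ifs at hn ⊢) <;>
    first
      | (exfalso; clear hn; omega)
      | (left; omega)
      | (right; left; omega)
      | (right; right; left; omega)
      | (right; right; right; omega)
      | omega

set_option maxHeartbeats 4000000 in
lemma len_descent1 (n : ℕ) (a b : ℤ) (hn : len (a, b, 1) = n + 1) :
    len (r1 (a, b, 1)) = n ∨ len (r1i (a, b, 1)) = n ∨ len (r2 (a, b, 1)) = n ∨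
      len (r2i (a, b, 1)) = n := by
  simp only [len, r1, r1i, r2, r2i] at hn ⊢
  rcases le_or_gt a 0 with ha | ha <;> rcases le_or_gt b 0 with hb | hb <;>
    rcases lt_trichotomy a b with hc | hc | hc <;>
    (try split_ifs at hn ⊢) <;>
    first
      | (exfalso; clear hn; omega)
      | (left; omega)
      | (right; left; omega)
      | (right; right; left; omega)
      | (right; right; right; omega)
      | omega

set_option maxHeartbeats 4000000 in
lemma len_descent2 (n : ℕ) (a b : ℤ) (hn : len (a, b, 2) = n + 1) :
    len (r1 (a, b, 2)) = n ∨ len (r1i (a, b, 2)) = n ∨ len (r2 (a, b, 2)) = n ∨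
      len (r2i (a, b, 2)) = n := by
  simp only [len, r1, r1i, r2, r2i] at hn ⊢
  rcases le_or_gt a 0 with ha | ha <;> rcases le_or_gt b 0 with hb | hb <;>
    rcases lt_trichotomy a b with hc | hc | hc <;>
    (try split_ifs at hn ⊢) <;>
    first
      | (exfalso; clear hn; omega)
      | (left; omega)
      | (right; left; omega)
      | (right; right; left; omega)
      | (right; right; right; omega)
      | omega

lemma len_descent (n : ℕ) : ∀ p, len p = n + 1 →
    len (r1 p) = n ∨ len (r1i p) = n ∨ len (r2 p) = n ∨ len (r2i p) = n :=
  forallX (len_descent0 n) (len_descent1 n) (len_descent2 n)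

lemma len_r1 : ∀ p, len (r1 p) ≤ len p + 1 := by
  refine forallX ?_ ?_ ?_ <;> intro a b <;> simp only [len, r1] <;> (try split_ifs) <;> omega
lemma len_r1i : ∀ p, len (r1i p) ≤ len p + 1 := by
  refine forallX ?_ ?_ ?_ <;> intro a b <;> simp only [len, r1i] <;> (try split_ifs) <;> omega
lemma len_r2 : ∀ p, len (r2 p) ≤ len p + 1 := by
  refine forallX ?_ ?_ ?_ <;> intro a b <;> simp only [len, r2] <;> (try split_ifs) <;> omega
lemma len_r2i : ∀ p, len (r2i p) ≤ len p + 1 := by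
  refine forallX ?_ ?_ ?_ <;> intro a b <;> simp only [len, r2i] <;> (try split_ifs) <;> omega

abbrev S : Set P := Set.range (PresentedGroup.of (rels := p3Rels))

lemma mem_S {g : P} : g ∈ S ∪ S⁻¹ ↔ g = s ∨ g = t ∨ g = s⁻¹ ∨ g = t⁻¹ := by
  simp only [S, Set.mem_union, Set.mem_inv, Set.mem_range, Fin.exists_fin_two, s, t,
    eq_comm (a := g), inv_eq_iff_eq_inv, or_assoc]

lemma ψ_s (g : P) : ψ (s * g) = r1 (ψ g) := by
  rw [ψ, map_mul, Φ_s]; rfl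
lemma ψ_t (g : P) : ψ (t * g) = r2 (ψ g) := by
  rw [ψ, map_mul, Φ_t]; rfl
lemma ψ_si (g : P) : ψ (s⁻¹ * g) = r1i (ψ g) := by
  rw [ψ, map_mul, map_inv, Φ_s]; rfl
lemma ψ_ti (g : P) : ψ (t⁻¹ * g) = r2i (ψ g) := by
  rw [ψ, map_mul, map_inv, Φ_t]; rfl

lemma len_word (w : List P) (hw : ∀ g ∈ w, g ∈ S ∪ S⁻¹) : len (ψ w.prod) ≤ w.length := by
  induction w with
  | nil => simp [ψ, len]
  | cons g w ih =>
    have ih := ih fun h hh => hw h (List.mem_cons_of_mem _ hh)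
    rw [List.prod_cons, List.length_cons]
    rcases mem_S.1 (hw g List.mem_cons_self) with rfl | rfl | rfl | rfl
    · rw [ψ_s]; exact (len_r1 _).trans (by omega)
    · rw [ψ_t]; exact (len_r2 _).trans (by omega)
    · rw [ψ_si]; exact (len_r1i _).trans (by omega)
    · rw [ψ_ti]; exact (len_r2i _).trans (by omega)

lemma exists_word (n : ℕ) : ∀ p, len p = n →
    ∃ w : List P, (∀ g ∈ w, g ∈ S ∪ S⁻¹) ∧ w.length = n ∧ ψ w.prod = p := by
  induction n with
  | zero =>
    intro p hp
    exact ⟨[], by simp, rfl, by simp [ψ, len_zero p hp]⟩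
  | succ n ih =>
    intro p hp
    have key : ∀ q, len q = n → ∀ g ∈ S ∪ S⁻¹, (∀ h, ψ h = q → ψ (g * h) = p) →
        ∃ w : List P, (∀ g ∈ w, g ∈ S ∪ S⁻¹) ∧ w.length = n + 1 ∧ ψ w.prod = p := by
      intro q hq g hg hgq
      obtain ⟨w, h1, h2, h3⟩ := ih q hq
      refine ⟨g :: w, ?_, by simp [h2], by rw [List.prod_cons]; exact hgq _ h3⟩
      intro k hk
      rcases List.mem_cons.1 hk with rfl | hk
      · exact hg
      · exact h1 k hk
    rcases len_descent n p hp with h | h | h | h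
    · exact key _ h s⁻¹ (mem_S.2 (by simp)) fun h hh => by
        rw [ψ_si, hh]; exact R1.symm_apply_apply p
    · exact key _ h s (mem_S.2 (by simp)) fun h hh => by
        rw [ψ_s, hh]; exact R1.apply_symm_apply p
    · exact key _ h t⁻¹ (mem_S.2 (by simp)) fun h hh => by
        rw [ψ_ti, hh]; exact R2.symm_apply_apply p
    · exact key _ h t (mem_S.2 (by simp)) fun h hh => by
        rw [ψ_t, hh]; exact R2.apply_symm_apply p

lemma ψ_surj : Function.Surjective ψ := fun p => by
  obtain ⟨w, _, _, h⟩ := exists_word _ p rfl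
  exact ⟨_, h⟩

lemma wordLength_eq (g : P) : wordLength S g = len (ψ g) := by
  obtain ⟨w, h1, h2, h3⟩ := exists_word _ (ψ g) rfl
  have hmem : len (ψ g) ∈
      {n | ∃ w : List P, (∀ x ∈ w, x ∈ S ∪ S⁻¹) ∧ w.length = n ∧ w.prod = g} :=
    ⟨w, h1, h2, ψ_inj h3⟩
  apply le_antisymm
  · exact Nat.sInf_le hmem
  · obtain ⟨v, k1, k2, k3⟩ := Nat.sInf_mem ⟨_, hmem⟩
    have := len_word v k1
    rw [k3, k2] at this
    exact this

lemma growth_eq (n : ℕ) : sphericalGrowth S n = Set.ncard {p : X | len p = n} := by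
  rw [sphericalGrowth]
  have h : {p : X | len p = n} = ψ '' {g | wordLength S g = n} := by
    ext p
    constructor
    · intro hp
      obtain ⟨g, rfl⟩ := ψ_surj p
      exact ⟨g, (wordLength_eq g).trans hp, rfl⟩
    · rintro ⟨g, hg, rfl⟩
      exact (wordLength_eq g).symm.trans hg
  rw [h, Set.ncard_image_of_injective _ ψ_inj]

/-! Counting the level sets of `len`. -/

noncomputable def segB (k : Fin 3) (c l u : ℤ) : Finset X := (Finset.Icc l u).image fun i => (c, i, k)
noncomputable def segA (k : Fin 3) (c l u : ℤ) : Finset X := (Finset.Icc l u).image fun i => (i, c, k)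
noncomputable def segD (k : Fin 3) (c l u : ℤ) : Finset X := (Finset.Icc l u).image fun i => (i, i - c, k)

lemma card_segB (k c l u) : (segB k c l u).card = (u + 1 - l).toNat := by
  rw [segB, Finset.card_image_of_injective, Int.card_Icc]
  intro i j h; simpa using h
lemma card_segA (k c l u) : (segA k c l u).card = (u + 1 - l).toNat := by
  rw [segA, Finset.card_image_of_injective, Int.card_Icc]
  intro i j h; simpa using h
lemma card_segD (k c l u) : (segD k c l u).card = (u + 1 - l).toNat := by
  rw [segD, Finset.card_image_of_injective, Int.card_Icc]
  intro i j h; simpa using h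

lemma mem_segB {k c l u a b j} : ((a, b, j) : X) ∈ segB k c l u ↔ j = k ∧ a = c ∧ l ≤ b ∧ b ≤ u := by
  simp only [segB, Finset.mem_image, Finset.mem_Icc, Prod.mk.injEq]
  constructor
  · rintro ⟨i, h, rfl, rfl, rfl⟩; simp [h]
  · rintro ⟨rfl, rfl, h⟩; exact ⟨b, h, rfl, rfl, rfl⟩
lemma mem_segA {k c l u a b j} : ((a, b, j) : X) ∈ segA k c l u ↔ j = k ∧ b = c ∧ l ≤ a ∧ a ≤ u := by
  simp only [segA, Finset.mem_image, Finset.mem_Icc, Prod.mk.injEq]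
  constructor
  · rintro ⟨i, h, rfl, rfl, rfl⟩; simp [h]
  · rintro ⟨rfl, rfl, h⟩; exact ⟨a, h, rfl, rfl, rfl⟩
lemma mem_segD {k c l u a b j} :
    ((a, b, j) : X) ∈ segD k c l u ↔ j = k ∧ a - b = c ∧ l ≤ a ∧ a ≤ u := by
  simp only [segD, Finset.mem_image, Finset.mem_Icc, Prod.mk.injEq]
  constructor
  · rintro ⟨i, h, rfl, rfl, rfl⟩; simp [h]
  · rintro ⟨rfl, rfl, h⟩; exact ⟨a, h, rfl, by ring, rfl⟩

/-- A point lies in at most one member of a pairwise disjoint list of finsets. -/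
lemma card_union_list (L : List (Finset X)) (hL : L.Pairwise Disjoint) (A : Set X)
    (hA : ∀ p, p ∈ A ↔ ∃ T ∈ L, p ∈ T) : A.ncard = (L.map Finset.card).sum := by
  induction L generalizing A with
  | nil =>
    have : A = ∅ := by ext p; simp [hA]
    simp [this]
  | cons T L ih =>
    rw [List.pairwise_cons] at hL
    have h1 := ih hL.2 {p | ∃ T ∈ L, p ∈ T} (fun p => Iff.rfl)
    have h2 : A = (T : Set X) ∪ {p | ∃ T ∈ L, p ∈ T} := by ext p; simp [hA]
    have hfin : {p : X | ∃ T ∈ L, p ∈ T}.Finite := by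
      have : {p : X | ∃ T ∈ L, p ∈ T} = ⋃ T ∈ {T | T ∈ L}, (T : Set X) := by ext p; simp
      rw [this]
      exact Set.Finite.biUnion (List.finite_toSet L) fun T _ => T.finite_toSet
    have hd : Disjoint (T : Set X) {p | ∃ T ∈ L, p ∈ T} := by
      rw [Set.disjoint_left]
      rintro p hp ⟨U, hU, hpU⟩
      exact Finset.disjoint_left.1 (hL.1 U hU) hp hpU
    rw [h2, Set.ncard_union_eq hd T.finite_toSet hfin, h1, Set.ncard_coe_finset]
    simp

lemma disj {A B : Finset X} (h0 : ∀ a b, (a, b, 0) ∈ A → (a, b, 0) ∉ B)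
    (h1 : ∀ a b, (a, b, 1) ∈ A → (a, b, 1) ∉ B)
    (h2 : ∀ a b, (a, b, 2) ∈ A → (a, b, 2) ∉ B) : Disjoint A B := by
  rw [Finset.disjoint_left]
  exact fun {p} => forallX (p := fun p => p ∈ A → p ∉ B) h0 h1 h2 p

noncomputable def evenList (m : ℤ) : List (Finset X) :=
  [segB 0 m 0 m, segB 0 (-m) (-m) 0, segA 0 m 1 (m - 1), segA 0 (-m) (1 - m) (-1),
    segD 0 m 1 (m - 1), segD 0 (-m) (1 - m) (-1),
    segA 1 m 1 m, segA 1 (-m) (1 - m) 0, segD 2 m 1 m, segD 2 (-m) (1 - m) 0]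

noncomputable def oddList (m : ℤ) : List (Finset X) :=
  [segA 0 m 0 0, segA 0 (-m) 0 0,
    segB 1 (m + 1) 0 m, segB 1 (-m) (-m) 0, segD 1 (m + 1) 1 m, segD 1 (-m) (1 - m) 0,
    segB 2 (m + 1) 1 (m + 1), segB 2 (-m) (-m) 0, segA 2 (m + 1) 1 m, segA 2 (-m) (1 - m) 0]

set_option maxHeartbeats 4000000 in
lemma count_even (m : ℕ) (hm : 0 < m) : Set.ncard {p : X | len p = 2 * m} = 10 * m - 2 := by
  rw [card_union_list (evenList m)]
  · simp only [evenList, List.map_cons, List.map_nil, List.sum_cons, List.sum_nil, card_segA,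
      card_segB, card_segD]
    omega
  · simp only [evenList, List.pairwise_cons, List.mem_cons, List.not_mem_nil, or_false,
      forall_eq_or_imp, forall_eq, IsEmpty.forall_iff, implies_true, and_true, List.Pairwise.nil]
    repeat' apply And.intro
    all_goals
      refine disj ?_ ?_ ?_ <;> intro a b <;>
      simp only [mem_segA, mem_segB, mem_segD, true_and, Fin.reduceEq, false_and, not_false_eq_true,
        implies_true, IsEmpty.forall_iff] <;> omega
  · refine forallX ?_ ?_ ?_ <;> intro a b <;>
      simp [evenList, mem_segA, mem_segB, mem_segD, len]
    · rcases le_or_gt a 0 with ha | ha <;> rcases le_or_gt b 0 with hb | hb <;>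
        rcases le_or_gt a b with hc | hc <;> split_ifs <;> omega
    · omega
    · omega

set_option maxHeartbeats 4000000 in
lemma count_odd (m : ℕ) (hm : 0 < m) : Set.ncard {p : X | len p = 2 * m + 1} = 8 * m + 6 := by
  rw [card_union_list (oddList m)]
  · simp only [oddList, List.map_cons, List.map_nil, List.sum_cons, List.sum_nil, card_segA,
      card_segB, card_segD]
    omega
  · simp only [oddList, List.pairwise_cons, List.mem_cons, List.not_mem_nil, or_false,
      forall_eq_or_imp, forall_eq, IsEmpty.forall_iff, implies_true, and_true, List.Pairwise.nil]
    repeat' apply And.intro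
    all_goals
      refine disj ?_ ?_ ?_ <;> intro a b <;>
      simp only [mem_segA, mem_segB, mem_segD, true_and, Fin.reduceEq, false_and, not_false_eq_true,
        implies_true, IsEmpty.forall_iff] <;> omega
  · refine forallX ?_ ?_ ?_ <;> intro a b <;>
      simp [oddList, mem_segA, mem_segB, mem_segD, len]
    · rcases le_or_gt a 0 with ha | ha <;> rcases le_or_gt b 0 with hb | hb <;>
        rcases le_or_gt a b with hc | hc <;> split_ifs <;> omega
    · omega
    · omega

lemma count_one : Set.ncard {p : X | len p = 1} = 4 := by
  rw [card_union_list [segA 1 0 0 1, {((0 : ℤ), (0 : ℤ), (2 : Fin 3))}, {((1 : ℤ), (1 : ℤ), (2 : Fin 3))}]]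
  · simp [card_segA]
  · simp [mem_segA]
  · refine forallX ?_ ?_ ?_ <;> intro a b <;> simp [mem_segA, len]
    · split_ifs <;> omega
    · omega
    · omega

lemma count_zero : Set.ncard {p : X | len p = 0} = 1 := by
  have : {p : X | len p = 0} = {(0, 0, 0)} := by
    ext p
    constructor
    · exact len_zero p
    · rintro rfl; simp [len]
  simp [this]

end P3Growth

theorem sphericalGrowth_p3 :
    sphericalGrowth (Set.range (PresentedGroup.of (rels := p3Rels))) 0 = 1 ∧
    sphericalGrowth (Set.range (PresentedGroup.of (rels := p3Rels))) 1 = 4 ∧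
    ∀ n : ℕ, 1 < n →
      (Even n → sphericalGrowth (Set.range (PresentedGroup.of (rels := p3Rels))) n + 2 = 5 * n) ∧
      (Odd n → sphericalGrowth (Set.range (PresentedGroup.of (rels := p3Rels))) n = 4 * n + 2) := by
  refine ⟨?_, ?_, ?_⟩
  · exact (P3Growth.growth_eq 0).trans P3Growth.count_zero
  · exact (P3Growth.growth_eq 1).trans P3Growth.count_one
  · intro n hn
    have h := P3Growth.growth_eq n
    constructor
    · rintro ⟨m, rfl⟩
      rw [← two_mul] at *
      rw [P3Growth.count_even m (by omega)] at h
      rw [h]; omega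
    · rintro ⟨m, rfl⟩
      rw [P3Growth.count_odd m (by omega)] at h
      rw [h]; omega
end

section
/- Let G be the wallpaper group p4 given by the presentation ⟨S, T | S⁴ = T² = (ST)⁴ = 1⟩, with generating set S the images of S, T (Cayley graph the tiling 4.8²). Then the spherical growth function satisfies δ(0) = 1, and for all n > 0: δ(n) = 8n/3 if n ≡ 0 (mod 3), δ(n) = (8n+1)/3 if n ≡ 1 (mod 3), and δ(n) = (8n−1)/3 if n ≡ 2 (mod 3). -/
/-- The relators of the wallpaper group `p4 = ⟨S,T | S⁴ = T² = (ST)⁴ = 1⟩`. -/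
def p4Rels : Set (FreeGroup (Fin 2)) :=
  {(FreeGroup.of 0) ^ 4, (FreeGroup.of 1) ^ 2, (FreeGroup.of 0 * FreeGroup.of 1) ^ 4}


namespace P4

abbrev G := PresentedGroup p4Rels

def s : G := PresentedGroup.of 0
def t : G := PresentedGroup.of 1

lemma s4 : s ^ 4 = 1 := by
  have : PresentedGroup.mk p4Rels ((FreeGroup.of 0) ^ 4) = 1 :=
    PresentedGroup.one_of_mem (by simp [p4Rels])
  simpa [s, PresentedGroup.of] using this

lemma t2 : t ^ 2 = 1 := by
  have : PresentedGroup.mk p4Rels ((FreeGroup.of 1) ^ 2) = 1 :=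
    PresentedGroup.one_of_mem (by simp [p4Rels])
  simpa [t, PresentedGroup.of] using this

lemma st4 : (s * t) ^ 4 = 1 := by
  have : PresentedGroup.mk p4Rels ((FreeGroup.of 0 * FreeGroup.of 1) ^ 4) = 1 :=
    PresentedGroup.one_of_mem (by simp [p4Rels])
  simpa [s, t, PresentedGroup.of] using this

/-- translation by `1` -/
def A : G := t * s ^ 2
/-- translation by `i` -/
def B : G := s * t * s

lemma tinv : t⁻¹ = t := by
  rw [inv_eq_iff_mul_eq_one, ← pow_two, t2]

lemma sinv : s⁻¹ = s ^ 3 := by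
  rw [inv_eq_iff_mul_eq_one, ← pow_succ', s4]

lemma comm : Commute A B := by
  have h : s * t * s * t = t * s⁻¹ * (t * s⁻¹) := by
    have h4 := st4
    have h1 : (s * t * (s * t)) * (s * t * (s * t)) = 1 := by
      rw [← h4]; simp only [pow_succ, pow_zero, one_mul, mul_assoc]
    have h2 := eq_inv_of_mul_eq_one_left h1
    simp only [mul_inv_rev, tinv] at h2
    simpa [mul_assoc] using h2
  have hB : B * A = t * s⁻¹ * t * s := by
    calc B * A = (s * t * s * t) * s ^ 2 := by simp [A, B, mul_assoc]
      _ = t * s⁻¹ * t * s := by rw [h, pow_two]; group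
  have hA : A * B = t * s⁻¹ * t * s := by
    calc A * B = t * (s ^ 3) * t * s := by
          simp only [A, B, pow_succ, pow_zero, one_mul, mul_assoc]
      _ = _ := by rw [← sinv]
  exact hA.trans hB.symm

def sg (k : Fin 4) (a b : ℤ) : G := A ^ a * B ^ b * s ^ (k : ℕ)

def dx (k : Fin 4) : ℤ := ![1, 0, -1, 0] k
def dy (k : Fin 4) : ℤ := ![0, 1, 0, -1] k

lemma sg_s (k : Fin 4) (a b : ℤ) : sg k a b * s = sg (k + 1) a b := by
  unfold sg
  rw [mul_assoc, ← pow_succ]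
  congr 1
  fin_cases k <;> simp [s4]

lemma sg_sinv (k : Fin 4) (a b : ℤ) : sg k a b * s⁻¹ = sg (k + 3) a b := by
  rw [mul_inv_eq_iff_eq_mul, sg_s]
  congr 1
  fin_cases k <;> rfl

lemma sk_t (k : Fin 4) : s ^ (k : ℕ) * t = A ^ dx k * B ^ dy k * s ^ ((k + 2 : Fin 4) : ℕ) := by
  have h4 := s4
  fin_cases k
  · change s ^ 0 * t = A ^ (1 : ℤ) * B ^ (0 : ℤ) * s ^ 2
    simp [A, mul_assoc, ← pow_add, s4]
  · change s ^ 1 * t = A ^ (0 : ℤ) * B ^ (1 : ℤ) * s ^ 3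
    simp [B, mul_assoc, ← pow_succ', s4]
  · change s ^ 2 * t = A ^ (-1 : ℤ) * B ^ (0 : ℤ) * s ^ 0
    have : s ^ 2 = (s ^ 2)⁻¹ := by
      rw [eq_inv_iff_mul_eq_one, ← pow_add, s4]
    simp [A, mul_inv_rev, tinv, ← this]
  · change s ^ 3 * t = A ^ (0 : ℤ) * B ^ (-1 : ℤ) * s ^ 1
    simp [B, mul_inv_rev, tinv, ← sinv, mul_assoc]

lemma sg_t (k : Fin 4) (a b : ℤ) : sg k a b * t = sg (k + 2) (a + dx k) (b + dy k) := by
  unfold sg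
  rw [mul_assoc, sk_t, zpow_add, zpow_add]
  have h : Commute (B ^ b) (A ^ dx k) := (comm.symm.zpow_zpow _ _)
  simp only [mul_assoc]
  rw [← mul_assoc (B ^ b) (A ^ dx k), h.eq]
  simp only [mul_assoc]

/-! ### Injectivity through an action -/

abbrev X := ℤ × ℤ × Fin 4

def pS : Equiv.Perm X where
  toFun x := (-x.2.1, x.1, x.2.2 + 1)
  invFun x := (x.2.1, -x.1, x.2.2 - 1)
  left_inv x := by simp
  right_inv x := by simp

lemma two_two (k : Fin 4) : k + 2 + 2 = k := by fin_cases k <;> rfl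

def pT : Equiv.Perm X where
  toFun x := (1 - x.1, -x.2.1, x.2.2 + 2)
  invFun x := (1 - x.1, -x.2.1, x.2.2 + 2)
  left_inv x := by simp [two_two]
  right_inv x := by simp [two_two]

@[simp] lemma pS_apply (a b : ℤ) (k : Fin 4) : pS (a, b, k) = (-b, a, k + 1) := rfl
@[simp] lemma pT_apply (a b : ℤ) (k : Fin 4) : pT (a, b, k) = (1 - a, -b, k + 2) := rfl

lemma rels_ok : ∀ r ∈ p4Rels, FreeGroup.lift ![pS, pT] r = 1 := by
  intro r hr
  simp only [p4Rels, Set.mem_insert_iff, Set.mem_singleton_iff] at hr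
  rcases hr with rfl | rfl | rfl
  · ext1 ⟨a, b, k⟩
    simp [pow_succ]
    fin_cases k <;> rfl
  · ext1 ⟨a, b, k⟩
    simp [pow_succ]
    fin_cases k <;> rfl
  · ext1 ⟨a, b, k⟩
    simp [pow_succ]
    fin_cases k <;> rfl

def psi : G →* Equiv.Perm X := PresentedGroup.toGroup rels_ok

lemma psi_s : psi s = pS := by simp [psi, s]
lemma psi_t : psi t = pT := by simp [psi, t]

lemma psi_A (a b : ℤ) (k : Fin 4) : psi A (a, b, k) = (a + 1, b, k) := by
  simp only [A, map_mul, map_pow, psi_s, psi_t, pow_two, Equiv.Perm.mul_apply, pS_apply, pT_apply]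
  refine Prod.ext (by simp; ring) (Prod.ext (by simp) ?_)
  fin_cases k <;> rfl

lemma psi_B (a b : ℤ) (k : Fin 4) : psi B (a, b, k) = (a, b + 1, k) := by
  simp only [B, map_mul, psi_s, psi_t, Equiv.Perm.mul_apply, pS_apply, pT_apply]
  refine Prod.ext (by simp) (Prod.ext (by simp; ring) ?_)
  fin_cases k <;> rfl

lemma psi_A_zpow (n : ℤ) : ∀ (a b : ℤ) (k : Fin 4), (psi A ^ n) (a, b, k) = (a + n, b, k) := by
  induction n using Int.induction_on with
  | zero => simp
  | succ n ih =>
    intro a b k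
    rw [zpow_add_one, Equiv.Perm.mul_apply, psi_A, ih]
    congr 1; ring
  | pred n ih =>
    intro a b k
    have : (psi A)⁻¹ (a, b, k) = (a - 1, b, k) := by
      rw [Equiv.Perm.inv_eq_iff_eq, psi_A]; simp
    rw [zpow_sub_one, Equiv.Perm.mul_apply, this, ih]
    congr 1; ring

lemma psi_B_zpow (n : ℤ) : ∀ (a b : ℤ) (k : Fin 4), (psi B ^ n) (a, b, k) = (a, b + n, k) := by
  induction n using Int.induction_on with
  | zero => simp
  | succ n ih =>
    intro a b k
    rw [zpow_add_one, Equiv.Perm.mul_apply, psi_B, ih]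
    congr 2; ring
  | pred n ih =>
    intro a b k
    have : (psi B)⁻¹ (a, b, k) = (a, b - 1, k) := by
      rw [Equiv.Perm.inv_eq_iff_eq, psi_B]; simp
    rw [zpow_sub_one, Equiv.Perm.mul_apply, this, ih]
    congr 2; ring

lemma psi_sg (k : Fin 4) (a b : ℤ) : psi (sg k a b) (0, 0, 0) = (a, b, k) := by
  have h : (psi s ^ (k : ℕ)) (0, 0, 0) = (0, 0, k) := by
    rw [psi_s]
    fin_cases k <;> simp [pow_succ] <;> rfl
  simp only [sg, map_mul, map_zpow, map_pow, Equiv.Perm.mul_apply]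
  rw [h, psi_B_zpow, psi_A_zpow]
  simp

lemma sg_inj {k k' : Fin 4} {a b a' b' : ℤ} (h : sg k a b = sg k' a' b') :
    k = k' ∧ a = a' ∧ b = b' := by
  have := psi_sg k a b
  rw [h, psi_sg] at this
  simp only [Prod.mk.injEq] at this
  tauto

/-! ### The length function -/

def M (a b : ℤ) : ℤ := max (3 * |a| + |b|) (|a| + 3 * |b|)

def c (k : Fin 4) (a b : ℤ) : ℤ :=
  ![0, if b < a then -1 else 1,
    (if b < a then -1 else 1) + (if -b < a then -1 else 1),
    if -b < a then -1 else 1] k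

def len (k : Fin 4) (a b : ℤ) : ℤ := M a b + c k a b

lemma len_s (k : Fin 4) (a b : ℤ) : len (k + 1) a b ≤ len k a b + 1 := by
  fin_cases k <;> simp [len, c] <;> split_ifs <;> omega

lemma len_sinv (k : Fin 4) (a b : ℤ) : len (k + 3) a b ≤ len k a b + 1 := by
  fin_cases k <;> simp [len, c] <;> split_ifs <;> omega

lemma len_t (k : Fin 4) (a b : ℤ) : len (k + 2) (a + dx k) (b + dy k) ≤ len k a b + 1 := by
  fin_cases k <;> simp [len, c, dx, dy, M, abs, -neg_le_self_iff] <;> grind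

lemma len_zero : len 0 0 0 = 0 := by simp [len, c, M]

lemma len_nonneg (k : Fin 4) (a b : ℤ) : 0 ≤ len k a b := by
  fin_cases k <;> simp [len, c, M] <;> grind

lemma len_eq_zero {k : Fin 4} {a b : ℤ} (h : len k a b = 0) : k = 0 ∧ a = 0 ∧ b = 0 := by
  fin_cases k <;> simp [len, c, M] at h ⊢ <;> grind

lemma len_desc (k : Fin 4) (a b : ℤ) (h : 0 < len k a b) :
    len (k + 1) a b = len k a b - 1 ∨ len (k + 3) a b = len k a b - 1 ∨
      len (k + 2) (a + dx k) (b + dy k) = len k a b - 1 := by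
  fin_cases k <;> simp [len, c, dx, dy, M] at h ⊢ <;> grind

abbrev gens : Set G := Set.range (PresentedGroup.of (rels := p4Rels))

lemma mem_gens (x : G) : x ∈ gens ∪ gens⁻¹ ↔ x = s ∨ x = t ∨ x = s⁻¹ := by
  have h : ∀ y : G, y ∈ gens ↔ y = s ∨ y = t := by
    intro y
    simp only [gens, Set.mem_range, Fin.exists_fin_two, s, t, eq_comm]
  rw [Set.mem_union, Set.mem_inv, h, h, inv_eq_iff_eq_inv, inv_eq_iff_eq_inv, tinv]
  tauto

lemma word_lower (w : List G) (hw : ∀ x ∈ w, x ∈ gens ∪ gens⁻¹) :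
    ∃ k a b, w.prod = sg k a b ∧ len k a b ≤ w.length := by
  induction w using List.reverseRecOn with
  | nil => exact ⟨0, 0, 0, by simp [sg], by simp [len_zero]⟩
  | append_singleton w x ih =>
    obtain ⟨k, a, b, h1, h2⟩ := ih (fun y hy => hw y (by simp [hy]))
    have hx := (mem_gens x).1 (hw x (by simp))
    rw [List.prod_append, List.prod_singleton, h1, List.length_append, List.length_singleton]
    push_cast
    rcases hx with rfl | rfl | rfl
    · exact ⟨_, _, _, sg_s k a b, by linarith [len_s k a b]⟩
    · exact ⟨_, _, _, sg_t k a b, by linarith [len_t k a b]⟩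
    · exact ⟨_, _, _, sg_sinv k a b, by linarith [len_sinv k a b]⟩

lemma word_upper (m : ℕ) : ∀ k a b, len k a b = m →
    ∃ w : List G, (∀ x ∈ w, x ∈ gens ∪ gens⁻¹) ∧ w.length = m ∧ w.prod = sg k a b := by
  induction m with
  | zero =>
    intro k a b h
    obtain ⟨rfl, rfl, rfl⟩ := len_eq_zero (by simpa using h)
    exact ⟨[], by simp, rfl, by simp [sg]⟩
  | succ m ih =>
    intro k a b h
    push_cast at h
    have key : ∀ (k' : Fin 4) (a' b' : ℤ) (x : G), x ∈ gens ∪ gens⁻¹ →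
        len k' a' b' = len k a b - 1 → sg k a b * x⁻¹ = sg k' a' b' →
        ∃ w : List G, (∀ x ∈ w, x ∈ gens ∪ gens⁻¹) ∧ w.length = m + 1 ∧ w.prod = sg k a b := by
      intro k' a' b' x hx hl hg
      obtain ⟨w, h1, h2, h3⟩ := ih k' a' b' (by linarith)
      refine ⟨w ++ [x], ?_, by simp [h2], ?_⟩
      · intro y hy
        rw [List.mem_append, List.mem_singleton] at hy
        rcases hy with hy | rfl
        · exact h1 y hy
        · exact hx
      · rw [List.prod_append, List.prod_singleton, h3, ← hg, inv_mul_cancel_right]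
    rcases len_desc k a b (by omega) with hd | hd | hd
    · exact key _ _ _ s⁻¹ ((mem_gens _).2 (by simp)) hd (by rw [inv_inv, sg_s])
    · exact key _ _ _ s ((mem_gens _).2 (by simp)) hd (by rw [sg_sinv])
    · exact key _ _ _ t ((mem_gens _).2 (by simp)) hd (by rw [tinv, sg_t])

lemma wordLength_sg (k : Fin 4) (a b : ℤ) : (wordLength gens (sg k a b) : ℤ) = len k a b := by
  obtain ⟨m, hm⟩ := Int.eq_ofNat_of_zero_le (len_nonneg k a b)
  have hmem : m ∈ {n | ∃ w : List G, (∀ x ∈ w, x ∈ gens ∪ gens⁻¹) ∧ w.length = n ∧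
      w.prod = sg k a b} := word_upper m k a b hm
  have h1 : wordLength gens (sg k a b) ≤ m := Nat.sInf_le hmem
  obtain ⟨w, hw, hl, hp⟩ := Nat.sInf_mem ⟨m, hmem⟩
  obtain ⟨k', a', b', e1, e2⟩ := word_lower w hw
  obtain ⟨rfl, rfl, rfl⟩ := sg_inj (hp.symm.trans e1)
  have h2 : w.length = wordLength gens (sg k a b) := hl
  rw [h2] at e2
  omega

lemma sg_surj (g : G) : ∃ k a b, g = sg k a b := by
  have h : g ∈ Subgroup.closure gens := by
    rw [PresentedGroup.closure_range_of]; trivial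
  rw [← Subgroup.mem_toSubmonoid, Subgroup.closure_toSubmonoid] at h
  obtain ⟨w, hw, rfl⟩ := Submonoid.exists_list_of_mem_closure h
  obtain ⟨k, a, b, h1, -⟩ := word_lower w hw
  exact ⟨k, a, b, h1⟩

/-! ### Counting -/

/-- East sector. -/
noncomputable def FE (m : ℤ) : Finset (ℤ × ℤ) :=
  (Finset.Ioc (m / 4) (m / 3)).image (fun a => (a, m - 3 * a)) ∪
  (Finset.Ioc (m / 4) ((m - 1) / 3)).image (fun a => (a, 3 * a - m))

/-- West sector. -/
noncomputable def FW (m : ℤ) : Finset (ℤ × ℤ) :=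
  (Finset.Ioc ((m - 1) / 4) (m / 3)).image (fun a => (-a, m - 3 * a)) ∪
  (Finset.Ioc ((m - 1) / 4) ((m - 1) / 3)).image (fun a => (-a, 3 * a - m))

/-- North sector. -/
noncomputable def FN (m : ℤ) : Finset (ℤ × ℤ) :=
  (Finset.Ioc (max ((m - 1) / 4) 0) (m / 3)).image (fun b => (m - 3 * b, b)) ∪
  (Finset.Ioc (m / 4) ((m - 1) / 3)).image (fun b => (3 * b - m, b))

/-- South sector. -/
noncomputable def FS (m : ℤ) : Finset (ℤ × ℤ) :=
  (Finset.Ioc (max ((m - 1) / 4) 0) (m / 3)).image (fun b => (m - 3 * b, -b)) ∪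
  (Finset.Ioc (m / 4) ((m - 1) / 3)).image (fun b => (3 * b - m, -b))

lemma mem_FE (m a b : ℤ) : (a, b) ∈ FE m ↔ (b < a ∧ -b < a) ∧ M a b = m := by
  simp only [FE, Finset.mem_union, Finset.mem_image, Finset.mem_Ioc, Prod.mk.injEq, M]
  have ha := abs_cases a
  have hb' := abs_cases b
  constructor
  · rintro (⟨x, h, h1, h2⟩ | ⟨x, h, h1, h2⟩) <;> omega
  · intro h
    rcases le_or_gt 0 b with hb | hb
    · exact Or.inl ⟨a, by omega, rfl, by omega⟩
    · exact Or.inr ⟨a, by omega, rfl, by omega⟩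

lemma mem_FW (m a b : ℤ) : (a, b) ∈ FW m ↔ (¬ b < a ∧ ¬ -b < a) ∧ M a b = m := by
  simp only [FW, Finset.mem_union, Finset.mem_image, Finset.mem_Ioc, Prod.mk.injEq, M]
  have ha := abs_cases a
  have hb' := abs_cases b
  constructor
  · rintro (⟨x, h, h1, h2⟩ | ⟨x, h, h1, h2⟩) <;> omega
  · intro h
    rcases le_or_gt 0 b with hb | hb
    · exact Or.inl ⟨-a, by omega, by omega, by omega⟩
    · exact Or.inr ⟨-a, by omega, by omega, by omega⟩

lemma mem_FN (m a b : ℤ) : (a, b) ∈ FN m ↔ (¬ b < a ∧ -b < a) ∧ M a b = m := by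
  simp only [FN, Finset.mem_union, Finset.mem_image, Finset.mem_Ioc, Prod.mk.injEq, M]
  have ha := abs_cases a
  have hb' := abs_cases b
  constructor
  · rintro (⟨x, h, h1, h2⟩ | ⟨x, h, h1, h2⟩) <;> omega
  · intro h
    rcases le_or_gt 0 a with hb | hb
    · exact Or.inl ⟨b, by omega, by omega, by omega⟩
    · exact Or.inr ⟨b, by omega, by omega, by omega⟩

lemma mem_FS (m a b : ℤ) : (a, b) ∈ FS m ↔ (b < a ∧ ¬ -b < a) ∧ M a b = m := by
  simp only [FS, Finset.mem_union, Finset.mem_image, Finset.mem_Ioc, Prod.mk.injEq, M]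
  have ha := abs_cases a
  have hb' := abs_cases b
  constructor
  · rintro (⟨x, h, h1, h2⟩ | ⟨x, h, h1, h2⟩) <;> omega
  · intro h
    rcases le_or_gt 0 a with hb | hb
    · exact Or.inl ⟨-b, by omega, by omega, by omega⟩
    · exact Or.inr ⟨-b, by omega, by omega, by omega⟩

lemma card_two (p q p' q' : ℤ) (f g : ℤ → ℤ × ℤ) (hf : Function.Injective f)
    (hg : Function.Injective g)
    (h : ∀ x y, x ∈ Finset.Ioc p q → y ∈ Finset.Ioc p' q' → f x ≠ g y) :
    ((Finset.Ioc p q).image f ∪ (Finset.Ioc p' q').image g).card =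
      (q - p).toNat + (q' - p').toNat := by
  rw [Finset.card_union_of_disjoint, Finset.card_image_of_injective _ hf,
    Finset.card_image_of_injective _ hg, Int.card_Ioc, Int.card_Ioc]
  rw [Finset.disjoint_left]
  intro z hz hz'
  obtain ⟨x, hx, rfl⟩ := Finset.mem_image.1 hz
  obtain ⟨y, hy, e⟩ := Finset.mem_image.1 hz'
  exact h x y hx hy e.symm

lemma card_FE (m : ℤ) : (FE m).card = (m / 3 - m / 4).toNat + ((m - 1) / 3 - m / 4).toNat := by
  apply card_two
  · intro x y h; simpa using h
  · intro x y h; simpa using h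
  · intro x y hx hy h
    simp only [Finset.mem_Ioc, Prod.mk.injEq] at hx hy h
    omega

lemma card_FW (m : ℤ) : (FW m).card =
    (m / 3 - (m - 1) / 4).toNat + ((m - 1) / 3 - (m - 1) / 4).toNat := by
  apply card_two
  · intro x y h; simpa using h
  · intro x y h; simpa using h
  · intro x y hx hy h
    simp only [Finset.mem_Ioc, Prod.mk.injEq] at hx hy h
    omega

lemma card_FN (m : ℤ) : (FN m).card =
    (m / 3 - max ((m - 1) / 4) 0).toNat + ((m - 1) / 3 - m / 4).toNat := by
  apply card_two
  · intro x y h; simpa using h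
  · intro x y h; simpa using h
  · intro x y hx hy h
    simp only [Finset.mem_Ioc, Prod.mk.injEq] at hx hy h
    omega

lemma card_FS (m : ℤ) : (FS m).card =
    (m / 3 - max ((m - 1) / 4) 0).toNat + ((m - 1) / 3 - m / 4).toNat := by
  apply card_two
  · intro x y h; simpa using h
  · intro x y h; simpa using h
  · intro x y hx hy h
    simp only [Finset.mem_Ioc, Prod.mk.injEq] at hx hy h
    omega

lemma icard_FE (m : ℤ) (hm : 1 ≤ m) :
    ((FE m).card : ℤ) = m / 3 + (m - 1) / 3 - 2 * (m / 4) := by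
  rw [card_FE]; omega

lemma icard_FW (m : ℤ) (hm : 1 ≤ m) :
    ((FW m).card : ℤ) = m / 3 + (m - 1) / 3 - 2 * ((m - 1) / 4) := by
  rw [card_FW]; omega

lemma icard_FN (m : ℤ) (hm : 1 ≤ m) :
    ((FN m).card : ℤ) = m / 3 + (m - 1) / 3 - m / 4 - (m - 1) / 4 := by
  rw [card_FN]; omega

lemma icard_FS (m : ℤ) (hm : 1 ≤ m) :
    ((FS m).card : ℤ) = m / 3 + (m - 1) / 3 - m / 4 - (m - 1) / 4 := by
  rw [card_FS]; omega

/-- Union of four sectors at given levels. -/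
noncomputable def F4 (e w n s : ℤ) : Finset (ℤ × ℤ) := (FE e ∪ FW w) ∪ (FN n ∪ FS s)

lemma card_F4 (e w n s : ℤ) :
    (F4 e w n s).card = ((FE e).card + (FW w).card) + ((FN n).card + (FS s).card) := by
  unfold F4
  rw [Finset.card_union_of_disjoint, Finset.card_union_of_disjoint, Finset.card_union_of_disjoint]
  · rw [Finset.disjoint_left]
    rintro ⟨a, b⟩ h h'
    rw [mem_FN] at h; rw [mem_FS] at h'; tauto
  · rw [Finset.disjoint_left]
    rintro ⟨a, b⟩ h h'
    rw [mem_FE] at h; rw [mem_FW] at h'; tauto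
  · rw [Finset.disjoint_left]
    rintro ⟨a, b⟩ h h'
    rw [Finset.mem_union, mem_FE, mem_FW] at h
    rw [Finset.mem_union, mem_FN, mem_FS] at h'
    tauto

noncomputable def F (n : ℤ) (k : Fin 4) : Finset (ℤ × ℤ) :=
  ![F4 n n n n, F4 (n + 1) (n - 1) (n - 1) (n + 1), F4 (n + 2) (n - 2) n n,
    F4 (n + 1) (n - 1) (n + 1) (n - 1)] k

lemma mem_F (n : ℤ) (k : Fin 4) (a b : ℤ) : (a, b) ∈ F n k ↔ len k a b = n := by
  by_cases h1 : b < a <;> by_cases h2 : -b < a <;> fin_cases k <;>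
    simp [F, F4, mem_FE, mem_FW, mem_FN, mem_FS, h1, h2, len, c] <;> omega

lemma growth_eq (n : ℕ) : sphericalGrowth gens n = ∑ k, (F n k).card := by
  have : {g : G | wordLength gens g = n} =
      (fun x : (Σ _ : Fin 4, ℤ × ℤ) => sg x.1 x.2.1 x.2.2) ''
        ((Finset.univ.sigma (F n) : Finset (Σ _ : Fin 4, ℤ × ℤ)) : Set (Σ _ : Fin 4, ℤ × ℤ)) := by
    ext g
    obtain ⟨k, a, b, rfl⟩ := sg_surj g
    have hw := wordLength_sg k a b
    simp only [Set.mem_ofPred_eq, Set.mem_image, Finset.mem_coe, Finset.mem_sigma,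
      Finset.mem_univ, true_and]
    constructor
    · intro h
      refine ⟨⟨k, a, b⟩, ?_, rfl⟩
      rw [mem_F, ← hw, h]
    · rintro ⟨⟨k', a', b'⟩, h, e⟩
      obtain ⟨rfl, rfl, rfl⟩ := sg_inj e
      rw [mem_F, ← hw] at h
      exact_mod_cast h
  unfold sphericalGrowth
  rw [this, Set.ncard_image_of_injective, Set.ncard_coe_finset, Finset.card_sigma]
  rintro ⟨k, a, b⟩ ⟨k', a', b'⟩ h
  obtain ⟨rfl, rfl, rfl⟩ := sg_inj h
  rfl

lemma growth_formula (n : ℕ) : sphericalGrowth gens n =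
    (F4 n n n n).card + (F4 (n + 1) (n - 1) (n - 1) (n + 1)).card +
    (F4 (n + 2) (n - 2) n n).card + (F4 (n + 1) (n - 1) (n + 1) (n - 1)).card := by
  rw [growth_eq, Fin.sum_univ_four]
  rfl

lemma growth_int (n : ℕ) (hn : 3 ≤ n) : (sphericalGrowth gens n : ℤ) =
    8 * ((n : ℤ) / 3) + (if n % 3 = 0 then 0 else if n % 3 = 1 then 3 else 5) := by
  rw [growth_formula n]
  simp only [card_F4]
  push_cast
  have h : (3 : ℤ) ≤ n := by exact_mod_cast hn
  generalize hN : (n : ℤ) = N at *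
  rw [icard_FE N (by omega), icard_FW N (by omega), icard_FN N (by omega), icard_FS N (by omega),
    icard_FE (N + 1) (by omega), icard_FW (N - 1) (by omega), icard_FN (N - 1) (by omega),
    icard_FS (N + 1) (by omega), icard_FE (N + 2) (by omega), icard_FW (N - 2) (by omega),
    icard_FN (N + 1) (by omega), icard_FS (N - 1) (by omega)]
  have e1 : N + 1 - 1 = N := by ring
  have e2 : N + 2 - 1 = N + 1 := by ring
  have e3 : N - 1 - 1 = N - 2 := by ring
  have e4 : N - 2 - 1 = N - 3 := by ring
  have f1 : (N - 2) / 4 = (N + 2) / 4 - 1 := by omega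
  have f2 : (N - 3) / 4 = (N + 1) / 4 - 1 := by omega
  have f3 : (N - 3) / 3 = N / 3 - 1 := by omega
  have f4 : (N - 2) / 3 = (N + 1) / 3 - 1 := by omega
  have f5 : (N - 1) / 3 = (N + 2) / 3 - 1 := by omega
  rw [e1, e2, e3, e4, f1, f2, f3, f4, f5]
  have f6 : N / 4 + (N - 1) / 4 + (N + 1) / 4 + (N + 2) / 4 = N - 1 := by
    have h4 : N % 4 = 0 ∨ N % 4 = 1 ∨ N % 4 = 2 ∨ N % 4 = 3 := by omega
    rcases h4 with h4 | h4 | h4 | h4 <;> omega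
  split_ifs <;> omega

end P4

/-- Spherical growth of `p4` with generators `S,T` (Cayley graph: the tiling `4.8²`):
`δ(0) = 1` and for `n > 0`: `δ(n) = 8n/3` if `n ≡ 0 (mod 3)`, `δ(n) = (8n+1)/3` if
`n ≡ 1 (mod 3)`, `δ(n) = (8n-1)/3` if `n ≡ 2 (mod 3)` (stated multiplied by 3 to avoid
division). -/
theorem sphericalGrowth_p4 :
    sphericalGrowth (Set.range (PresentedGroup.of (rels := p4Rels))) 0 = 1 ∧
    ∀ n : ℕ, 0 < n →
      (n % 3 = 0 →
        3 * sphericalGrowth (Set.range (PresentedGroup.of (rels := p4Rels))) n = 8 * n) ∧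
      (n % 3 = 1 →
        3 * sphericalGrowth (Set.range (PresentedGroup.of (rels := p4Rels))) n = 8 * n + 1) ∧
      (n % 3 = 2 →
        3 * sphericalGrowth (Set.range (PresentedGroup.of (rels := p4Rels))) n + 1 = 8 * n) := by
  refine ⟨?_, ?_⟩
  · rw [P4.growth_formula 0]
    simp only [P4.card_F4, P4.card_FE, P4.card_FW, P4.card_FN, P4.card_FS]
    norm_num
    decide
  · intro n hn
    rcases lt_or_ge n 3 with h | h
    · rw [P4.growth_formula n]
      simp only [P4.card_F4, P4.card_FE, P4.card_FW, P4.card_FN, P4.card_FS]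
      interval_cases n <;> norm_num <;> decide
    · have : (sphericalGrowth (Set.range (PresentedGroup.of (rels := p4Rels))) n : ℤ) = _ :=
        P4.growth_int n h
      refine ⟨fun hr => ?_, fun hr => ?_, fun hr => ?_⟩ <;> simp only [hr] at this <;>
        norm_num at this <;> omega
end

section
/- Let G be the wallpaper group p3 given by the presentation ⟨S₁, S₂ | S₁³ = S₂³ = (S₁S₂)³ = 1⟩, with generating set S the images of S₁, S₂ (Cayley graph the tiling (3.6)²). Then the cumulative growth function satisfies γ(0) = 1, γ(1) = 5, and for all n > 1: γ(n) = (9n² + 10n − 4)/4 if n is even, and γ(n) = (9n² + 8n + 3)/4 if n is odd. -/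
namespace P3

/-- Points of the model: rotation part and translation part `a + b ω`. -/
abbrev V := Fin 3 × ℤ × ℤ

def r1 : Equiv.Perm V where
  toFun v := (v.1 + 1, -v.2.2, v.2.1 - v.2.2)
  invFun v := (v.1 - 1, v.2.2 - v.2.1, -v.2.1)
  left_inv v := by ext <;> simp
  right_inv v := by ext <;> simp

def r2 : Equiv.Perm V where
  toFun v := (v.1 + 1, -v.2.2 + 1, v.2.1 - v.2.2)
  invFun v := (v.1 - 1, v.2.2 - (v.2.1 - 1), -(v.2.1 - 1))
  left_inv v := by ext <;> simp
  right_inv v := by ext <;> simp <;> ring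

/-- The explicit length function. -/
def len : V → ℕ
  | (0, a, b) => if a = 0 ∧ b ≠ 0 then 2 * b.natAbs + 1
      else max (2 * a).natAbs (max (2 * b).natAbs (2 * (a - b)).natAbs)
  | (1, a, b) => max (2 * a - 1).natAbs (max (2 * b).natAbs (2 * (a - b) - 1).natAbs)
  | (2, a, b) => max (2 * a - 1).natAbs (max (2 * b - 1).natAbs (2 * (a - b)).natAbs)

abbrev P := PresentedGroup p3Rels

abbrev s : P := PresentedGroup.of 0
abbrev t : P := PresentedGroup.of 1

lemma fin3 (k : Fin 3) : k + 1 + 1 + 1 = k := by fin_cases k <;> rfl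

lemma rels_ok : ∀ r ∈ p3Rels, FreeGroup.lift (![r1, r2] : Fin 2 → Equiv.Perm V) r = 1 := by
  intro r hr
  rcases hr with rfl | rfl | rfl
  · ext v <;> simp [pow_succ, r1, fin3] <;> ring
  · ext v <;> simp [pow_succ, r2, fin3] <;> ring
  · ext v <;> simp [pow_succ, r1, r2, fin3] <;> ring

def φ : P →* Equiv.Perm V := PresentedGroup.toGroup rels_ok

lemma φs : φ s = r1 := by simp [φ, s]
lemma φt : φ t = r2 := by simp [φ, t]

lemma s3 : s ^ 3 = 1 := by
  have : PresentedGroup.mk p3Rels (FreeGroup.of 0 ^ 3) = 1 :=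
    PresentedGroup.one_of_mem (by simp [p3Rels])
  rw [← this]; simp only [map_pow, map_mul]; rfl
lemma t3 : t ^ 3 = 1 := by
  have : PresentedGroup.mk p3Rels (FreeGroup.of 1 ^ 3) = 1 :=
    PresentedGroup.one_of_mem (by simp [p3Rels])
  rw [← this]; simp only [map_pow, map_mul]; rfl
lemma st3 : (s * t) ^ 3 = 1 := by
  have : PresentedGroup.mk p3Rels ((FreeGroup.of 0 * FreeGroup.of 1) ^ 3) = 1 :=
    PresentedGroup.one_of_mem (by simp [p3Rels])
  rw [← this]; simp only [map_pow, map_mul]; rfl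

def x : P := t * s⁻¹
def y : P := s * x * s⁻¹
def z : P := s * y * s⁻¹

lemma xyz : x * y * z = 1 := by
  have h : x * y * z = t ^ 3 * (s ^ 3)⁻¹ := by
    simp only [x, y, z, pow_succ, pow_zero, one_mul]; group
  rw [h, t3, s3]; simp

lemma zyx : z * y * x = 1 := by
  have e : s⁻¹ * s⁻¹ = s := by
    have : s = s ^ 3 * (s⁻¹ * s⁻¹) := by group
    rw [s3, one_mul] at this
    exact this.symm
  have h1 : z * y * x = s * (s * t * (s⁻¹ * s⁻¹) * t * (s⁻¹ * s⁻¹) * t) * s⁻¹ := by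
    simp only [x, y, z]; group
  have h2 : s * t * s * t * s * t = (s * t) ^ 3 := by
    simp only [pow_succ, pow_zero, one_mul, mul_assoc]
  rw [h1, e, h2, st3]; group

lemma comm_xy : Commute x y := by
  have h1 := xyz
  have h2 : y * x * z = 1 := by
    have := zyx
    rw [mul_assoc, mul_eq_one_iff_eq_inv] at this
    rw [this]; group
  have : x * y * z = y * x * z := by rw [h1, h2]
  exact mul_right_cancel this

lemma hz : z = x⁻¹ * y⁻¹ := by
  rw [← mul_inv_rev, ← mul_eq_one_iff_eq_inv, ← mul_assoc]
  exact zyx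

def ψ (v : V) : P := x ^ v.2.1 * y ^ v.2.2 * s ^ (v.1 : ℕ)

lemma s_succ (k : Fin 3) : s ^ ((k + 1 : Fin 3) : ℕ) = s * s ^ (k : ℕ) := by
  rw [← pow_succ']
  fin_cases k
  · rfl
  · rfl
  · exact s3.symm

lemma ψ1 (v : V) : ψ (r1 v) = s * ψ v := by
  obtain ⟨k, a, b⟩ := v
  have e1 : s * x ^ a = y ^ a * s := by
    have : y ^ a = s * x ^ a * s⁻¹ := by simp only [y]; rw [conj_zpow]
    rw [this]; group
  have e2 : s * y ^ b = z ^ b * s := by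
    have : z ^ b = s * y ^ b * s⁻¹ := by simp only [z]; rw [conj_zpow]
    rw [this]; group
  have e3 : z ^ b = x ^ (-b) * y ^ (-b) := by
    rw [hz, (comm_xy.inv_inv).mul_zpow]; simp
  have c : y ^ a * x ^ (-b) = x ^ (-b) * y ^ a := ((comm_xy.symm).zpow_zpow a (-b)).eq
  simp only [ψ, r1, Equiv.coe_fn_mk, s_succ]
  calc x ^ (-b) * y ^ (a - b) * (s * s ^ (k : ℕ))
      = x ^ (-b) * y ^ a * y ^ (-b) * s * s ^ (k : ℕ) := by
        rw [sub_eq_add_neg, zpow_add]; simp only [mul_assoc]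
    _ = y ^ a * (x ^ (-b) * y ^ (-b)) * s * s ^ (k : ℕ) := by
        rw [← c]; simp only [mul_assoc]
    _ = y ^ a * (s * y ^ b) * s ^ (k : ℕ) := by rw [← e3, e2]; simp only [mul_assoc]
    _ = (y ^ a * s) * y ^ b * s ^ (k : ℕ) := by simp only [mul_assoc]
    _ = s * (x ^ a * y ^ b * s ^ (k : ℕ)) := by rw [← e1]; simp only [mul_assoc]

lemma ψ2 (v : V) : ψ (r2 v) = t * ψ v := by
  have h : ψ (r2 v) = x * ψ (r1 v) := by
    simp only [ψ, r1, r2, Equiv.coe_fn_mk]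
    rw [add_comm (-v.2.2) 1, zpow_add, zpow_one]; simp only [mul_assoc]
  rw [h, ψ1, x]; group

abbrev o : V := (0, 0, 0)

lemma of_cases (i : Fin 2) : PresentedGroup.of (rels := p3Rels) i = s ∨
    PresentedGroup.of (rels := p3Rels) i = t := by
  fin_cases i
  · exact Or.inl rfl
  · exact Or.inr rfl

lemma ψφ (g : P) : ∀ v, ψ (φ g v) = g * ψ v := by
  have hg : g ∈ Subgroup.closure (Set.range (PresentedGroup.of (rels := p3Rels))) := by
    rw [PresentedGroup.closure_range_of]; trivial
  induction hg using Subgroup.closure_induction with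
  | mem g h =>
    obtain ⟨i, rfl⟩ := h
    rcases of_cases i with h | h <;> rw [h]
    · rw [φs]; exact ψ1
    · rw [φt]; exact ψ2
  | one => simp
  | mul a b _ _ ha hb => intro v; rw [map_mul, Equiv.Perm.mul_apply, ha, hb, mul_assoc]
  | inv a _ ha =>
    intro v
    have := ha (φ a⁻¹ v)
    rw [← Equiv.Perm.mul_apply, ← map_mul, mul_inv_cancel, map_one, Equiv.Perm.one_apply] at this
    rw [this]; group

lemma orbit_inj : Function.Injective (fun g : P => φ g o) := by
  intro g h e
  have := congrArg ψ e
  simp only [ψφ] at this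
  exact mul_right_cancel this

abbrev S : Set P := Set.range (PresentedGroup.of (rels := p3Rels))

lemma len_r1 (v : V) : len (r1 v) ≤ len v + 1 ∧ len v ≤ len (r1 v) + 1 := by
  obtain ⟨k, a, b⟩ := v
  fin_cases k <;> simp only [r1, Equiv.coe_fn_mk, len, Fin.zero_eta, Fin.mk_one, Fin.reduceFinMk,
    Fin.reduceAdd, zero_add] <;> (try split_ifs) <;> omega

lemma len_r2 (v : V) : len (r2 v) ≤ len v + 1 ∧ len v ≤ len (r2 v) + 1 := by
  obtain ⟨k, a, b⟩ := v
  fin_cases k <;> simp only [r2, Equiv.coe_fn_mk, len, Fin.zero_eta, Fin.mk_one, Fin.reduceFinMk,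
    Fin.reduceAdd, zero_add] <;> (try split_ifs) <;> omega

lemma len_zero (v : V) (h : len v = 0) : v = o := by
  obtain ⟨k, a, b⟩ := v
  fin_cases k <;> simp only [len, Fin.zero_eta, Fin.mk_one, Fin.reduceFinMk] at h ⊢
  · split_ifs at h
    have ha : a = 0 := by omega
    have hb : b = 0 := by omega
    rw [ha, hb]
  · omega
  · omega

lemma len_desc (v : V) (n : ℕ) (h : len v = n + 1) :
    len (r1 v) = n ∨ len (r2 v) = n ∨ len (r1.symm v) = n ∨ len (r2.symm v) = n := by
  obtain ⟨k, a, b⟩ := v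
  have e1 : (0 : Fin 3) - 1 = 2 := rfl
  have e2 : (1 : Fin 3) - 1 = 0 := rfl
  have e3 : (2 : Fin 3) - 1 = 1 := rfl
  fin_cases k <;> simp only [r1, r2, Equiv.coe_fn_mk, Equiv.coe_fn_symm_mk, len, Fin.zero_eta,
    Fin.mk_one, Fin.reduceFinMk, Fin.reduceAdd, zero_add, e1, e2, e3] at h ⊢
  · by_cases ha : a ≤ 0
    · rcases lt_trichotomy b 0 with hb | hb | hb
      · left; split_ifs at h <;> omega
      · right; right; left; split_ifs at h <;> omega
      · right; right; left; split_ifs at h <;> omega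
    · rw [if_neg (by omega)] at h
      by_cases hb : b ≤ 0
      · right; right; right; omega
      · right; left; omega
  · by_cases ha : a ≤ 0
    · rcases lt_trichotomy b 0 with hb | hb | hb
      · left; omega
      · right; right; left; split_ifs <;> omega
      · right; right; left; split_ifs <;> omega
    · by_cases hb : b ≤ 0
      · right; right; right; split_ifs <;> omega
      · right; left; omega
  · by_cases ha : a ≤ 0
    · rcases lt_trichotomy b 0 with hb | hb | hb
      · left; split_ifs <;> omega
      · by_cases ha : a = 0
        · left; split_ifs <;> omega
        · right; right; left; omega
      · right; right; left; omega
    · by_cases hb : b ≤ 0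
      · right; right; right; omega
      · by_cases hab : a ≤ b
        · right; left; split_ifs <;> omega
        · right; right; right; omega

lemma len_step (g : P) (hg : g ∈ S ∪ S⁻¹) (v : V) : len (φ g v) ≤ len v + 1 := by
  have key : ∀ i v, len (φ (PresentedGroup.of (rels := p3Rels) i) v) ≤ len v + 1 ∧
      len v ≤ len (φ (PresentedGroup.of (rels := p3Rels) i) v) + 1 := by
    intro i v
    rcases of_cases i with h | h <;> rw [h]
    · rw [φs]; exact len_r1 v
    · rw [φt]; exact len_r2 v
  rcases hg with ⟨i, rfl⟩ | ⟨i, hi⟩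
  · exact (key i v).1
  · have := (key i (φ g v)).2
    rw [hi, ← Equiv.Perm.mul_apply, ← map_mul, inv_mul_cancel, map_one] at this
    exact this

lemma len_word (w : List P) (hw : ∀ x ∈ w, x ∈ S ∪ S⁻¹) : len (φ w.prod o) ≤ w.length := by
  induction w with
  | nil => simp [len]
  | cons g w ih =>
    rw [List.prod_cons, map_mul, Equiv.Perm.mul_apply, List.length_cons]
    have h1 := len_step g (hw g (by simp)) (φ w.prod o)
    have h2 := ih (fun x hx => hw x (by simp [hx]))
    omega

lemma hsS : s ∈ S := ⟨0, rfl⟩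
lemma htS : t ∈ S := ⟨1, rfl⟩

lemma exists_word (n : ℕ) : ∀ v, len v = n →
    ∃ w : List P, (∀ x ∈ w, x ∈ S ∪ S⁻¹) ∧ w.length = n ∧ φ w.prod o = v := by
  induction n with
  | zero =>
    intro v hv
    exact ⟨[], by simp, rfl, by simp [len_zero v hv]⟩
  | succ n ih =>
    intro v hv
    have aux : ∀ g : P, g ∈ S ∪ S⁻¹ → ∀ u, len u = n → φ g u = v →
        ∃ w : List P, (∀ x ∈ w, x ∈ S ∪ S⁻¹) ∧ w.length = n + 1 ∧ φ w.prod o = v := by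
      intro g hg u hu hgu
      obtain ⟨w, h1, h2, h3⟩ := ih u hu
      refine ⟨g :: w, ?_, by simp [h2], ?_⟩
      · intro x hx
        rcases List.mem_cons.1 hx with rfl | hx
        · exact hg
        · exact h1 x hx
      · rw [List.prod_cons, map_mul, Equiv.Perm.mul_apply, h3, hgu]
    rcases len_desc v n hv with h | h | h | h
    · exact aux s⁻¹ (Or.inr (by simpa using hsS)) _ h (by rw [map_inv, φs]; simp)
    · exact aux t⁻¹ (Or.inr (by simpa using htS)) _ h (by rw [map_inv, φt]; simp)
    · exact aux s (Or.inl hsS) _ h (by rw [φs]; simp)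
    · exact aux t (Or.inl htS) _ h (by rw [φt]; simp)

lemma wordLength_eq (g : P) : wordLength S g = len (φ g o) := by
  obtain ⟨w, h1, h2, h3⟩ := exists_word _ (φ g o) rfl
  have h4 : w.prod = g := orbit_inj h3
  apply le_antisymm
  · exact Nat.sInf_le ⟨w, h1, h2, h4⟩
  · refine le_csInf ⟨_, w, h1, h2, h4⟩ ?_
    rintro m ⟨u, hu, rfl, rfl⟩
    exact len_word u hu

lemma growth_eq (n : ℕ) : cumulativeGrowth S n = Set.ncard {v : V | len v ≤ n} := by
  have : {v : V | len v ≤ n} = (fun g : P => φ g o) '' {g | wordLength S g ≤ n} := by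
    ext v
    constructor
    · intro hv
      obtain ⟨w, -, -, h3⟩ := exists_word _ v rfl
      refine ⟨w.prod, ?_, h3⟩
      simp only [Set.mem_ofPred_eq, wordLength_eq, h3]
      exact hv
    · rintro ⟨g, hg, rfl⟩
      simpa only [Set.mem_ofPred_eq, wordLength_eq] using hg
  rw [this, Set.ncard_image_of_injective _ orbit_inj, cumulativeGrowth]

/-! Counting lattice points. -/

def tri (j C : ℕ) : Finset (Σ _ : ℕ, ℕ) := (Finset.range j).sigma fun i => Finset.range (C - i)

lemma tri_card (j C : ℕ) (h : j ≤ C + 1) : 2 * ((tri j C).card : ℤ) = 2 * C * j - j * (j - 1) := by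
  simp only [tri, Finset.card_sigma, Finset.card_range]
  induction j with
  | zero => simp
  | succ j ih =>
    have := ih (by omega)
    rw [Finset.sum_range_succ]
    push_cast [Nat.cast_sub (show j ≤ C by omega)]
    push_cast at this
    linarith

lemma hex_card (Q : ℤ × ℤ → Prop) (j C j' C' : ℕ) (hi lo : ℤ) (hj : j ≤ C + 1) (hj' : j' ≤ C' + 1)
    (h : ∀ a b, Q (a, b) ↔ (1 ≤ a ∧ a ≤ j ∧ b ≤ hi ∧ hi - b < C - (a - 1)) ∨
      (a ≤ 0 ∧ -a < j' ∧ lo ≤ b ∧ b - lo < C' + a)) :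
    {p | Q p}.Finite ∧
    2 * ({p | Q p}.ncard : ℤ) = (2 * C * j - j * (j - 1)) + (2 * C' * j' - j' * (j' - 1)) := by
  let f : (Σ _ : ℕ, ℕ) → ℤ × ℤ := fun p => ((p.1 : ℤ) + 1, hi - p.2)
  let g : (Σ _ : ℕ, ℕ) → ℤ × ℤ := fun p => (-(p.1 : ℤ), lo + p.2)
  have hf : Function.Injective f := by
    rintro ⟨a, b⟩ ⟨c, d⟩ h
    simp only [f, Prod.mk.injEq] at h
    have h1 : a = c := by omega
    have h2 : b = d := by omega
    rw [h1, h2]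
  have hg : Function.Injective g := by
    rintro ⟨a, b⟩ ⟨c, d⟩ h
    simp only [g, Prod.mk.injEq] at h
    have h1 : a = c := by omega
    have h2 : b = d := by omega
    rw [h1, h2]
  have e : {p | Q p} = ((((tri j C).image f) ∪ ((tri j' C').image g) : Finset (ℤ × ℤ)) :
      Set (ℤ × ℤ)) := by
    ext ⟨a, b⟩
    simp only [Set.mem_ofPred_eq, h, Finset.coe_union, Finset.coe_image, Set.mem_union,
      Set.mem_image, Finset.mem_coe, tri, Finset.mem_sigma, Finset.mem_range, Sigma.exists, f, g,
      Prod.mk.injEq]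
    constructor
    · rintro (h | h)
      · exact Or.inl ⟨(a - 1).toNat, (hi - b).toNat, by omega, by omega, by omega⟩
      · exact Or.inr ⟨(-a).toNat, (b - lo).toNat, by omega, by omega, by omega⟩
    · rintro (⟨i, k, h⟩ | ⟨i, k, h⟩)
      · left; omega
      · right; omega
  have hd : Disjoint ((tri j C).image f) ((tri j' C').image g) := by
    rw [Finset.disjoint_left]
    intro p hp hq
    obtain ⟨u, -, rfl⟩ := Finset.mem_image.1 hp
    obtain ⟨w, -, hw⟩ := Finset.mem_image.1 hq
    simp only [f, g, Prod.mk.injEq] at hw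
    omega
  rw [e]
  refine ⟨Finset.finite_toSet _, ?_⟩
  rw [Set.ncard_coe_finset, Finset.card_union_of_disjoint hd, Finset.card_image_of_injective _ hf,
    Finset.card_image_of_injective _ hg, ← tri_card j C hj, ← tri_card j' C' hj']
  push_cast
  ring

lemma split_card (n : ℕ) (h0 : {p : ℤ × ℤ | len (0, p) ≤ n}.Finite)
    (h1 : {p : ℤ × ℤ | len (1, p) ≤ n}.Finite) (h2 : {p : ℤ × ℤ | len (2, p) ≤ n}.Finite) :
    {v : V | len v ≤ n}.ncard = {p : ℤ × ℤ | len (0, p) ≤ n}.ncard +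
      {p : ℤ × ℤ | len (1, p) ≤ n}.ncard + {p : ℤ × ℤ | len (2, p) ≤ n}.ncard := by
  have inj : ∀ k : Fin 3, Function.Injective (fun p : ℤ × ℤ => ((k, p) : V)) := by
    intro k p q h; simpa using h
  have e : {v : V | len v ≤ n} =
      ((fun p : ℤ × ℤ => ((0, p) : V)) '' {p : ℤ × ℤ | len (0, p) ≤ n} ∪
      (fun p : ℤ × ℤ => ((1, p) : V)) '' {p : ℤ × ℤ | len (1, p) ≤ n}) ∪
      (fun p : ℤ × ℤ => ((2, p) : V)) '' {p : ℤ × ℤ | len (2, p) ≤ n} := by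
    ext ⟨k, p⟩
    fin_cases k <;> simp
  rw [e, Set.ncard_union_eq _ ((h0.image _).union (h1.image _)) (h2.image _),
    Set.ncard_union_eq _ (h0.image _) (h1.image _), Set.ncard_image_of_injective _ (inj 0),
    Set.ncard_image_of_injective _ (inj 1), Set.ncard_image_of_injective _ (inj 2)]
  · rw [Set.disjoint_left]
    rintro _ ⟨p, -, rfl⟩ ⟨q, -, h⟩
    simp at h
  · rw [Set.disjoint_left]
    rintro _ (⟨p, -, rfl⟩ | ⟨p, -, rfl⟩) ⟨q, -, h⟩ <;> simp at h

lemma count_odd (m : ℕ) : ({v : V | len v ≤ 2 * m + 1}.ncard : ℤ) =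
    (3 * m ^ 2 + 3 * m + 1) + 2 * (m + 1) * (3 * m + 2) := by
  obtain ⟨f0, c0⟩ := hex_card (fun p => len (0, p) ≤ 2 * m + 1) m (2 * m) (m + 1) (2 * m + 1) m (-m)
    (by omega) (by omega) (by intro a b; simp only [len]; split_ifs <;> omega)
  obtain ⟨f1, c1⟩ := hex_card (fun p => len (1, p) ≤ 2 * m + 1) (m + 1) (2 * m + 1)
    (m + 1) (2 * m + 1) m (-m)
    (by omega) (by omega) (by intro a b; simp only [len]; omega)
  obtain ⟨f2, c2⟩ := hex_card (fun p => len (2, p) ≤ 2 * m + 1) (m + 1) (2 * m + 1)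
    (m + 1) (2 * m + 1) (m + 1) (-m)
    (by omega) (by omega) (by intro a b; simp only [len]; omega)
  rw [split_card _ f0 f1 f2]
  push_cast at c0 c1 c2 ⊢
  linarith

lemma count_even (m : ℕ) (hm : 1 ≤ m) : ({v : V | len v ≤ 2 * m}.ncard : ℤ) =
    (3 * m ^ 2 + 3 * m + 1 - 2) + 2 * (3 * m ^ 2 + m) := by
  obtain ⟨f0, c0⟩ := hex_card (fun p => len (0, p) ≤ 2 * m ∨ p = (0, (m : ℤ)) ∨ p = (0, -(m : ℤ)))
    m (2 * m) (m + 1) (2 * m + 1) m (-m)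
    (by omega) (by omega)
    (by intro a b; simp only [len, Prod.mk.injEq]; split_ifs <;> omega)
  obtain ⟨f1, c1⟩ := hex_card (fun p => len (1, p) ≤ 2 * m) m (2 * m) m (2 * m) m (-m)
    (by omega) (by omega) (by intro a b; simp only [len]; omega)
  obtain ⟨f2, c2⟩ := hex_card (fun p => len (2, p) ≤ 2 * m) m (2 * m) m (2 * m) m (1 - m)
    (by omega) (by omega) (by intro a b; simp only [len]; omega)
  have f0' : {p : ℤ × ℤ | len (0, p) ≤ 2 * m}.Finite := f0.subset fun p hp => Or.inl hp
  have e : {p : ℤ × ℤ | len (0, p) ≤ 2 * m ∨ p = (0, (m : ℤ)) ∨ p = (0, -(m : ℤ))} =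
      {p : ℤ × ℤ | len (0, p) ≤ 2 * m} ∪ {(0, (m : ℤ)), (0, -(m : ℤ))} := by
    ext p; rfl
  have hd : Disjoint {p : ℤ × ℤ | len (0, p) ≤ 2 * m} {(0, (m : ℤ)), (0, -(m : ℤ))} := by
    rw [Set.disjoint_right]
    rintro p (rfl | rfl) hp
    · have hp' : len (0, 0, (m : ℤ)) ≤ 2 * m := hp
      rw [len, if_pos ⟨rfl, by omega⟩] at hp'
      omega
    · have hp' : len (0, 0, -(m : ℤ)) ≤ 2 * m := hp
      rw [len, if_pos ⟨rfl, by omega⟩] at hp'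
      omega
  rw [e, Set.ncard_union_eq hd f0', Set.ncard_pair (by simp; omega)] at c0
  rw [split_card _ f0' f1 f2]
  push_cast at c0 c1 c2 ⊢
  linarith

lemma count_zero : {v : V | len v ≤ 0}.ncard = 1 := by
  have : {v : V | len v ≤ 0} = {o} := by
    ext v
    simp only [Set.mem_ofPred_eq, Set.mem_singleton_iff]
    constructor
    · intro h; exact len_zero v (by omega)
    · rintro rfl; simp [len]
  rw [this, Set.ncard_singleton]

end P3

/-- Cumulative growth of `p3` with generators `S₁,S₂` (Cayley graph: the tiling `(3.6)²`):
`γ(0) = 1`, `γ(1) = 5`, and for `n > 1`: `γ(n) = (9n² + 10n - 4)/4` if `n` is even and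
`γ(n) = (9n² + 8n + 3)/4` if `n` is odd (stated multiplied by 4 to avoid division). -/
theorem cumulativeGrowth_p3 :
    cumulativeGrowth (Set.range (PresentedGroup.of (rels := p3Rels))) 0 = 1 ∧
    cumulativeGrowth (Set.range (PresentedGroup.of (rels := p3Rels))) 1 = 5 ∧
    ∀ n : ℕ, 1 < n →
      (Even n →
        4 * cumulativeGrowth (Set.range (PresentedGroup.of (rels := p3Rels))) n + 4 =
          9 * n ^ 2 + 10 * n) ∧
      (Odd n →
        4 * cumulativeGrowth (Set.range (PresentedGroup.of (rels := p3Rels))) n =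
          9 * n ^ 2 + 8 * n + 3) := by
  refine ⟨?_, ?_, ?_⟩
  · rw [P3.growth_eq, P3.count_zero]
  · rw [P3.growth_eq]
    have := P3.count_odd 0
    norm_num at this
    exact_mod_cast this
  · intro n hn
    constructor
    · rintro ⟨m, rfl⟩
      rw [P3.growth_eq, ← two_mul]
      have := P3.count_even m (by omega)
      apply Nat.cast_injective (R := ℤ)
      rw [Nat.cast_add, Nat.cast_mul, this]; push_cast; ring
    · rintro ⟨m, rfl⟩
      rw [P3.growth_eq]
      have := P3.count_odd m
      apply Nat.cast_injective (R := ℤ)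
      rw [Nat.cast_mul, this]; push_cast; ring
end
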